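/- Let G be a group, K a positive integer, A ⊆ G a K-approximate subgroup, and μ a finitely additive measure on the subsets of G, invariant under left translation by every element of ⟨A⟩, with μ(A) = 1. Then there is a sequence (S_i : i < ω) of symmetric subsets of G with S_0 = A such that for every i: S_{i+1}⁴ ⊆ S_i⁴, a·S_{i+1}⁸·a⁻¹ ⊆ S_i⁴ for all a ∈ A, and A is covered by finitely many left translates of S_{i+1}; consequently H = ⋂_{i<ω} S_i⁴ is a subgroup of ⟨A⟩ contained in A⁴ which is normalized by A (hence normal in ⟨A⟩), and every set S_i⁴ ⊇ H is wide in A. -/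

import Mathlib

open scoped Pointwise ENNReal


/-- A subset of a group is symmetric if it contains 1 and is closed under inverse. -/
def IsSymmetric {G : Type*} [Group G] (A : Set G) : Prop :=
  (1 : G) ∈ A ∧ ∀ a ∈ A, a⁻¹ ∈ A

/-- A symmetric subset `A` is a `K`-approximate subgroup if `A·A ⊆ E·A`
for some finite `E` with `|E| ≤ K`. -/
def IsApproxSubgroup {G : Type*} [Group G] (K : ℕ) (A : Set G) : Prop :=
  IsSymmetric A ∧ ∃ E : Finset G, E.card ≤ K ∧ A * A ⊆ (E : Set G) * A

/-- A finitely additive measure on all subsets of `G`, with values in `[0,∞]`. -/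
def IsFinAddMeasure {G : Type*} [Group G] (μ : Set G → ℝ≥0∞) : Prop :=
  μ ∅ = 0 ∧ ∀ X Y : Set G, Disjoint X Y → μ (X ∪ Y) = μ X + μ Y

section Helpers

variable {G : Type*} [Group G]

theorem fam_mono {μ : Set G → ℝ≥0∞} (hμ : IsFinAddMeasure μ) {X Y : Set G} (h : X ⊆ Y) :
    μ X ≤ μ Y := by
  have := hμ.2 X (Y \ X) Set.disjoint_sdiff_right
  rw [Set.union_sdiff_cancel h] at this
  rw [this]; exact le_self_add

theorem fam_split {μ : Set G → ℝ≥0∞} (hμ : IsFinAddMeasure μ) (X Y : Set G) :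
    μ X = μ (X ∩ Y) + μ (X \ Y) := by
  rw [← hμ.2 _ _ Set.disjoint_sdiff_inter.symm, Set.inter_union_sdiff]

theorem fam_union_le {μ : Set G → ℝ≥0∞} (hμ : IsFinAddMeasure μ) (X Y : Set G) :
    μ (X ∪ Y) ≤ μ X + μ Y := by
  have := hμ.2 X (Y \ X) Set.disjoint_sdiff_right
  rw [Set.union_sdiff_self] at this
  rw [this]
  gcongr
  exact fam_mono hμ Set.sdiff_subset

theorem fam_biUnion_le {μ : Set G → ℝ≥0∞} (hμ : IsFinAddMeasure μ) (Z : Finset G)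
    (F : G → Set G) (c : ℝ≥0∞) (h : ∀ z ∈ Z, μ (F z) ≤ c) :
    μ (⋃ z ∈ Z, F z) ≤ Z.card * c := by
  classical
  induction Z using Finset.induction_on with
  | empty => simp [hμ.1]
  | insert a s ha ih =>
    rw [Finset.set_biUnion_insert, Finset.card_insert_of_notMem ha]
    refine (fam_union_le hμ _ _).trans ?_
    have h1 := h a (Finset.mem_insert_self _ _)
    have h2 := ih fun z hz => h z (Finset.mem_insert_of_mem hz)
    push_cast
    rw [add_mul, one_mul, add_comm]
    gcongr

/-- `P` is covered by finitely many left translates of `Q` by elements of `Γ`. -/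
def TrCov (Γ : Subgroup G) (P Q : Set G) : Prop :=
  ∃ Z : Finset G, (∀ z ∈ Z, z ∈ Γ) ∧ P ⊆ (Z : Set G) * Q

theorem TrCov.trans {Γ : Subgroup G} {P Q R : Set G} (h1 : TrCov Γ P Q) (h2 : TrCov Γ Q R) :
    TrCov Γ P R := by
  classical
  obtain ⟨Z, hZ, hP⟩ := h1
  obtain ⟨W, hW, hQ⟩ := h2
  refine ⟨Z * W, ?_, ?_⟩
  · intro z hz
    obtain ⟨a, ha, b, hb, rfl⟩ := Finset.mem_mul.1 hz
    exact Γ.mul_mem (hZ a ha) (hW b hb)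
  · rw [Finset.coe_mul, mul_assoc]
    exact hP.trans (Set.mul_subset_mul_left hQ)

theorem TrCov.mul_right {Γ : Subgroup G} {P Q : Set G} (h1 : TrCov Γ P Q) (R : Set G) :
    TrCov Γ (P * R) (Q * R) := by
  obtain ⟨Z, hZ, hP⟩ := h1
  refine ⟨Z, hZ, ?_⟩
  rw [← mul_assoc]
  exact Set.mul_subset_mul_right hP

theorem TrCov.of_subset {Γ : Subgroup G} {P Q : Set G} (h : P ⊆ Q) : TrCov Γ P Q :=
  ⟨{1}, by simp [Γ.one_mem], by simpa using h⟩

theorem TrCov.of_finset {Γ : Subgroup G} {P Q : Set G} (hP : P ⊆ Γ) (hQ : Q ⊆ Γ)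
    (Z : Finset G) (h : P ⊆ (Z : Set G) * Q) : TrCov Γ P Q := by
  classical
  refine ⟨Z.filter (· ∈ Γ), by simp, ?_⟩
  intro p hp
  obtain ⟨z, hz, q, hq, rfl⟩ := h hp
  refine ⟨z, ?_, q, hq, rfl⟩
  simp only [Finset.coe_filter, Set.mem_ofPred_eq]
  exact ⟨hz, (Γ.mul_mem_cancel_right (hQ hq)).1 (hP hp)⟩

theorem TrCov.measure_le {Γ : Subgroup G} {μ : Set G → ℝ≥0∞} (hμ : IsFinAddMeasure μ)
    (hinv : ∀ g ∈ Γ, ∀ X : Set G, μ (g • X) = μ X) {P Q : Set G} (h : TrCov Γ P Q) :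
    ∃ n : ℕ, μ P ≤ n * μ Q := by
  obtain ⟨Z, hZ, hP⟩ := h
  refine ⟨Z.card, (fam_mono hμ ?_).trans
    (fam_biUnion_le hμ Z (fun z => z • Q) (μ Q) fun z hz => (hinv z (hZ z hz) Q).le)⟩
  intro p hp
  obtain ⟨z, hz, q, hq, rfl⟩ := hP hp
  simp only [Set.mem_iUnion]
  exact ⟨z, hz, q, hq, rfl⟩

theorem pow_subset_subgroup {Γ : Subgroup G} {A : Set G} (h : A ⊆ Γ) (n : ℕ) :
    A ^ n ⊆ Γ := by
  induction n with
  | zero => simp [Γ.one_mem]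
  | succ n ih =>
    rw [pow_succ]
    rintro _ ⟨x, hx, y, hy, rfl⟩
    exact Γ.mul_mem (ih hx) (h hy)

theorem trCov_pow {K : ℕ} {A : Set G} (hA : IsApproxSubgroup K A) (n : ℕ) :
    TrCov (Subgroup.closure A) (A ^ (n + 1)) A := by
  induction n with
  | zero => simpa using TrCov.of_subset subset_rfl
  | succ n ih =>
    rw [pow_succ]
    refine (ih.mul_right A).trans ?_
    obtain ⟨E, -, hE⟩ := hA.2
    refine TrCov.of_finset ?_ Subgroup.subset_closure E hE
    rw [← pow_two]
    exact pow_subset_subgroup Subgroup.subset_closure 2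

/-- Sanders' theorem, qualitative version. -/
theorem sanders_qual {Γ : Subgroup G} {A : Set G} (hAΓ : A ⊆ Γ)
    {μ : Set G → ℝ≥0∞} (hμ : IsFinAddMeasure μ)
    (hinv : ∀ g ∈ Γ, ∀ X : Set G, μ (g • X) = μ X)
    {S : Set G} (hS : IsSymmetric S) (hSΓ : S ⊆ Γ) (h0 : μ S ≠ 0)
    (hfin : μ (S * S) ≠ ∞) (hfin2 : μ (A * S) ≠ ∞) (m : ℕ) :
    ∃ T : Set G, IsSymmetric T ∧ T ⊆ Γ ∧ T ^ m ⊆ S ^ 4 ∧ TrCov Γ A T := by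
  classical
  set P : Set (Set G) := {B | B ⊆ S ∧ μ B ≠ 0} with hP
  set c : ℝ≥0∞ := ⨅ B ∈ P, μ (B * S) with hc
  have hSP : S ∈ P := ⟨subset_rfl, h0⟩
  have hcle : ∀ B ∈ P, c ≤ μ (B * S) := fun B hB => iInf₂_le B hB
  have hctop : c ≠ ∞ := ne_top_of_le_ne_top hfin (hcle S hSP)
  have hc0 : c ≠ 0 := by
    have : μ S ≤ c := by
      refine le_iInf₂ fun B hB => ?_
      obtain ⟨b, hb⟩ : B.Nonempty := by
        by_contra hne
        rw [Set.not_nonempty_iff_eq_empty] at hne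
        exact hB.2 (hne ▸ hμ.1)
      rw [← hinv b (hSΓ (hB.1 hb)) S]
      refine fam_mono hμ ?_
      rintro _ ⟨s, hs, rfl⟩
      exact ⟨b, hb, s, hs, rfl⟩
    intro h
    rw [h] at this
    exact h0 (le_antisymm this zero_le)
  set δ : ℝ≥0∞ := c / (m + 1 : ℕ) with hδ
  have hmδ : ((m + 1 : ℕ) : ℝ≥0∞) * δ = c :=
    ENNReal.mul_div_cancel (by simp) (ENNReal.natCast_ne_top _)
  have hδ0 : δ ≠ 0 := by
    intro h
    rw [h, mul_zero] at hmδ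
    exact hc0 hmδ.symm
  have hδtop : δ ≠ ∞ := ENNReal.div_ne_top hctop (by simp)
  have hmlt : (m : ℝ≥0∞) * δ < c := by
    rw [← hmδ]
    push_cast
    rw [add_mul, one_mul]
    exact ENNReal.lt_add_right (ENNReal.mul_ne_top (ENNReal.natCast_ne_top _) hδtop) hδ0
  obtain ⟨B, hBP, hB⟩ : ∃ B ∈ P, μ (B * S) < c + δ := by
    have : c < c + δ := ENNReal.lt_add_right hctop hδ0
    conv_lhs at this => rw [hc]
    simpa only [iInf_lt_iff, exists_prop] using this
  set Y : Set G := B * S with hY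
  set T : Set G := {g | g ∈ Γ ∧ μ (g • B ∩ B) ≠ 0} with hT
  have hBtop : μ B ≠ ∞ := by
    refine ne_top_of_le_ne_top hfin (fam_mono hμ ?_)
    intro b hb
    exact ⟨b, hBP.1 hb, 1, hS.1, mul_one b⟩
  refine ⟨T, ⟨⟨Γ.one_mem, by simpa using hBP.2⟩, ?_⟩, fun g hg => hg.1, ?_, ?_⟩
  · rintro g ⟨hg, h⟩
    refine ⟨Γ.inv_mem hg, ?_⟩
    rw [← hinv g hg, Set.smul_set_inter, smul_inv_smul, Set.inter_comm]
    exact h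
  · have step : ∀ g ∈ T, μ (Y \ g • Y) ≤ δ := by
      rintro g ⟨hg, h⟩
      have h1 : c ≤ μ (Y ∩ g • Y) := by
        refine (hcle (g • B ∩ B) ⟨fun x hx => hBP.1 hx.2, h⟩).trans (fam_mono hμ ?_)
        rintro _ ⟨x, ⟨⟨b, hb, rfl⟩, hx⟩, s, hs, rfl⟩
        refine ⟨⟨_, hx, s, hs, rfl⟩, ⟨b * s, ⟨b, hb, s, hs, rfl⟩, ?_⟩⟩
        simp [mul_assoc]
      have h2 := fam_split hμ Y (g • Y)
      have h3 : c + μ (Y \ g • Y) ≤ c + δ := by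
        refine le_trans ?_ hB.le
        rw [h2]
        gcongr
      exact (ENNReal.add_le_add_iff_left hctop).1 h3
    have main : ∀ n : ℕ, ∀ g ∈ T ^ n, μ (Y \ g • Y) ≤ n * δ := by
      intro n
      induction n with
      | zero =>
        intro g hg
        rw [pow_zero, Set.mem_one] at hg
        simp [hg, hμ.1]
      | succ n ih =>
        intro g hg
        rw [pow_succ'] at hg
        obtain ⟨g₁, hg₁, h, hh, rfl⟩ := hg
        have hsub : Y \ (g₁ * h) • Y ⊆ (Y \ g₁ • Y) ∪ g₁ • (Y \ h • Y) := by
          intro y hy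
          by_cases hy1 : y ∈ g₁ • Y
          · right
            rw [Set.smul_set_sdiff, ← mul_smul]
            exact ⟨hy1, hy.2⟩
          · exact Or.inl ⟨hy.1, hy1⟩
        refine (fam_mono hμ hsub).trans ((fam_union_le hμ _ _).trans ?_)
        rw [hinv g₁ hg₁.1]
        have e1 := step g₁ hg₁
        have e2 := ih h hh
        push_cast
        rw [add_mul, one_mul, add_comm]
        gcongr
    intro g hg
    have hlt : μ (Y \ g • Y) < μ Y := ((main m g hg).trans_lt hmlt).trans_le (hcle B hBP)
    have hne : (Y ∩ g • Y).Nonempty := by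
      by_contra hne
      rw [Set.not_nonempty_iff_eq_empty] at hne
      have := fam_split hμ Y (g • Y)
      rw [hne, hμ.1, zero_add] at this
      exact hlt.ne this.symm
    obtain ⟨y, ⟨b, hb, s, hs, rfl⟩, ⟨_, ⟨b', hb', s', hs', rfl⟩, h⟩⟩ := hne
    have hge : g = b * s * s'⁻¹ * b'⁻¹ := by
      simp only [smul_eq_mul] at h
      rw [← h]; group
    rw [hge, pow_succ, pow_succ, pow_two]
    exact Set.mul_mem_mul (Set.mul_mem_mul (Set.mul_mem_mul (hBP.1 hb) hs) (hS.2 _ hs'))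
      (hS.2 _ (hBP.1 hb'))
  · by_contra hcov
    have key : ∀ n : ℕ, ∃ R : Finset G, (R : Set G) ⊆ A ∧ μ ((R : Set G) * B) = n * μ B := by
      intro n
      induction n with
      | zero => exact ⟨∅, by simp, by simp [hμ.1]⟩
      | succ n ih =>
        obtain ⟨R, hRA, hR⟩ := ih
        obtain ⟨g, hgA, hg⟩ : ∃ g ∈ A, g ∉ (R : Set G) * T := by
          by_contra hall
          push Not at hall
          exact hcov ⟨R, fun z hz => hAΓ (hRA hz), hall⟩
        refine ⟨insert g R, ?_, ?_⟩
        · rw [Finset.coe_insert]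
          exact Set.insert_subset hgA hRA
        have hnull : μ (g • B ∩ ((R : Set G) * B)) = 0 := by
          have h1 : g • B ∩ ((R : Set G) * B) ⊆ ⋃ r ∈ R, (g • B ∩ r • B) := by
            rintro x ⟨hx, r, hr, b, hb, rfl⟩
            simp only [Set.mem_iUnion]
            exact ⟨r, hr, hx, b, hb, rfl⟩
          have h2 := fam_biUnion_le hμ R (fun r => g • B ∩ r • B) 0 (by
            intro r hr
            by_contra hpos
            apply hg
            refine ⟨r, hr, r⁻¹ * g, ⟨Γ.mul_mem (Γ.inv_mem (hAΓ (hRA hr))) (hAΓ hgA), ?_⟩, by simp⟩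
            rw [← hinv r (hAΓ (hRA hr)), Set.smul_set_inter, ← mul_smul, mul_inv_cancel_left]
            intro h
            exact hpos h.le)
          rw [mul_zero] at h2
          exact le_antisymm ((fam_mono hμ h1).trans h2) zero_le
        have h3 := fam_split hμ (g • B) ((R : Set G) * B)
        rw [hnull, zero_add, hinv g (hAΓ hgA)] at h3
        have h4 : ((insert g R : Finset G) : Set G) * B
            = ((R : Set G) * B) ∪ (g • B \ ((R : Set G) * B)) := by
          rw [Set.union_sdiff_self, Finset.coe_insert, Set.insert_eq, Set.union_mul,
            Set.singleton_mul, Set.union_comm]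
          rfl
        rw [h4, hμ.2 _ _ Set.disjoint_sdiff_right, hR, ← h3]
        push_cast
        ring
    obtain ⟨n, hn⟩ := ENNReal.exists_nat_mul_gt hBP.2 hfin2
    obtain ⟨R, hRA, hR⟩ := key n
    rw [← hR] at hn
    exact absurd (fam_mono hμ (Set.mul_subset_mul hRA hBP.1)) (not_le.2 hn)

theorem wide_conj {Γ : Subgroup G} {A T : Set G} (Z : Finset G)
    (h : ∀ z ∈ Z, TrCov Γ (A * {z⁻¹}) T) :
    ∃ W : Finset G, (W : Set G) ⊆ A ∧
      A ⊆ (W : Set G) * {x | ∀ z ∈ Z, z * x * z⁻¹ ∈ T⁻¹ * T} := by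
  classical
  choose! V hVΓ hV using h
  have h1 : ∀ a ∈ A, ∀ z ∈ Z, ∃ v ∈ V z, v⁻¹ * (a * z⁻¹) ∈ T := by
    intro a ha z hz
    obtain ⟨v, hv, t, ht, he⟩ := hV z hz ⟨a, ha, z⁻¹, rfl, rfl⟩
    refine ⟨v, hv, ?_⟩
    simp only at he
    rw [← he]
    simpa using ht
  choose! f hf hfT using h1
  let F : A → (Z → (Z.biUnion V)) := fun a z =>
    ⟨f a z, Finset.mem_biUnion.2 ⟨z, z.2, hf a a.2 z z.2⟩⟩
  have hfin : (Set.range fun y : Set.range F => ((Set.rangeSplitting F y : A) : G)).Finite :=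
    Set.finite_range _
  refine ⟨hfin.toFinset, ?_, ?_⟩
  · rw [Set.Finite.coe_toFinset]
    rintro _ ⟨y, rfl⟩
    exact (Set.rangeSplitting F y).2
  · intro a ha
    rw [Set.Finite.coe_toFinset]
    set r := Set.rangeSplitting F ⟨F ⟨a, ha⟩, Set.mem_range_self _⟩ with hr
    have hFr : F r = F ⟨a, ha⟩ := Set.apply_rangeSplitting F _
    refine ⟨r, ⟨⟨F ⟨a, ha⟩, Set.mem_range_self _⟩, rfl⟩, (r : G)⁻¹ * a, ?_, by simp⟩
    intro z hz
    have he : f r z = f a z := congrArg Subtype.val (congrFun hFr ⟨z, hz⟩)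
    have h1 := hfT r r.2 z hz
    have h2 := hfT a ha z hz
    rw [he] at h1
    refine ⟨_, Set.inv_mem_inv.2 h1, _, h2, ?_⟩
    simp only
    group

theorem mem_closure_pow {A : Set G} (hA : IsSymmetric A) {z : G}
    (hz : z ∈ Subgroup.closure A) : ∃ n : ℕ, z ∈ A ^ n := by
  have hinv : A⁻¹ = A := by
    ext x
    rw [Set.mem_inv]
    exact ⟨fun h => by simpa using hA.2 _ h, fun h => hA.2 _ h⟩
  induction hz using Subgroup.closure_induction with
  | mem x hx => exact ⟨1, by simpa using hx⟩
  | one => exact ⟨0, by simp⟩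
  | mul x y _ _ hx hy =>
    obtain ⟨n, hn⟩ := hx
    obtain ⟨m, hm⟩ := hy
    exact ⟨n + m, by rw [pow_add]; exact Set.mul_mem_mul hn hm⟩
  | inv x _ hx =>
    obtain ⟨n, hn⟩ := hx
    refine ⟨n, ?_⟩
    rw [← hinv, inv_pow]
    exact Set.inv_mem_inv.2 hn

theorem conj_mem_pow {S U : Set G} {z : G} (h : ∀ x ∈ S, z * x * z⁻¹ ∈ U) (n : ℕ) :
    ∀ x ∈ S ^ n, z * x * z⁻¹ ∈ U ^ n := by
  induction n with
  | zero =>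
    intro x hx
    rw [pow_zero, Set.mem_one] at hx
    simp [hx]
  | succ n ih =>
    intro x hx
    rw [pow_succ] at hx ⊢
    obtain ⟨a, ha, b, hb, rfl⟩ := hx
    refine ⟨_, ih a ha, _, h b hb, ?_⟩
    simp only
    group

/-- The inductive invariant along the chain. -/
def ChainGood (A S : Set G) : Prop :=
  IsSymmetric S ∧ (∃ n : ℕ, S ⊆ A ^ (n + 1)) ∧ TrCov (Subgroup.closure A) A S

theorem chain_step {K : ℕ} {A : Set G} (hA : IsApproxSubgroup K A)
    {μ : Set G → ℝ≥0∞} (hμ : IsFinAddMeasure μ)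
    (hinv : ∀ g ∈ Subgroup.closure A, ∀ X : Set G, μ (g • X) = μ X)
    (hμA : μ A = 1) {S : Set G} (hS : ChainGood A S) :
    ∃ S' : Set G, ChainGood A S' ∧ ∀ a ∈ A, ∀ x ∈ S' ^ 8, a * x * a⁻¹ ∈ S ^ 4 := by
  classical
  obtain ⟨hSs, ⟨n, hn⟩, hcov⟩ := hS
  have hAΓ : A ⊆ Subgroup.closure A := Subgroup.subset_closure
  have hfinpow : ∀ k : ℕ, μ (A ^ (k + 1)) ≠ ∞ := by
    intro k
    obtain ⟨N, hN⟩ := (trCov_pow hA k).measure_le hμ hinv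
    rw [hμA, mul_one] at hN
    exact ne_top_of_le_ne_top (ENNReal.natCast_ne_top N) hN
  have h0 : μ S ≠ 0 := by
    intro h
    obtain ⟨N, hN⟩ := hcov.measure_le hμ hinv
    rw [hμA, h, mul_zero] at hN
    exact absurd hN (by simp)
  have hSΓ : S ⊆ Subgroup.closure A := hn.trans (pow_subset_subgroup hAΓ _)
  have hf1 : μ (S * S) ≠ ∞ := by
    refine ne_top_of_le_ne_top (hfinpow (n + 1 + n)) (fam_mono hμ ?_)
    rw [show n + 1 + n + 1 = (n + 1) + (n + 1) by ring, pow_add]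
    exact Set.mul_subset_mul hn hn
  have hf2 : μ (A * S) ≠ ∞ := by
    refine ne_top_of_le_ne_top (hfinpow (n + 1)) (fam_mono hμ ?_)
    rw [pow_succ']
    exact Set.mul_subset_mul_left hn
  obtain ⟨T, hTs, hTΓ, hTpow, hTcov⟩ := sanders_qual hAΓ hμ hinv hSs hSΓ h0 hf1 hf2 18
  obtain ⟨Z, hZΓ, hZ⟩ := id hTcov
  have hTinv : T⁻¹ ⊆ T := fun x hx => by simpa using hTs.2 _ hx
  obtain ⟨W, hWA, hW⟩ := wide_conj (Γ := Subgroup.closure A) (A := A) (T := T) (Z.image (·⁻¹)) (by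
    intro z hz
    obtain ⟨w, hw, rfl⟩ := Finset.mem_image.1 hz
    obtain ⟨k, hk⟩ := mem_closure_pow hA.1 (hZΓ w hw)
    refine TrCov.trans (TrCov.of_subset ?_) ((trCov_pow hA k).trans hTcov)
    rw [pow_succ', inv_inv]
    exact Set.mul_subset_mul_left (Set.singleton_subset_iff.2 hk))
  set S' : Set G := {x | ∀ z ∈ Z.image (·⁻¹), z * x * z⁻¹ ∈ T⁻¹ * T} with hS'
  have hS's : IsSymmetric S' := by
    refine ⟨?_, ?_⟩
    · intro z hz
      exact ⟨1, by simpa using hTs.1, 1, hTs.1, by simp⟩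
    · intro x hx z hz
      obtain ⟨t, ht, u, hu, he⟩ := hx z hz
      refine ⟨u⁻¹, Set.inv_mem_inv.2 hu, t⁻¹, ht, ?_⟩
      simp only at he ⊢
      rw [← mul_inv_rev, he]
      group
  have hconj : ∀ a ∈ A, ∀ x ∈ S' ^ 8, a * x * a⁻¹ ∈ S ^ 4 := by
    intro a ha x hx
    obtain ⟨z, hz, t, ht, he⟩ := hZ (hA.1.2 a ha)
    have hz' : z⁻¹ ∈ Z.image (·⁻¹) := Finset.mem_image_of_mem _ hz
    have h1 := conj_mem_pow (S := S') (U := T * T) (z := z⁻¹)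
      (fun y hy => Set.mul_subset_mul_right hTinv (hy _ hz')) 8 x hx
    rw [← pow_two, ← pow_mul] at h1
    apply hTpow
    have h2 : a * x * a⁻¹ = t⁻¹ * (z⁻¹ * x * z⁻¹⁻¹) * t := by
      simp only at he
      have : a = t⁻¹ * z⁻¹ := by rw [← mul_inv_rev, he, inv_inv]
      rw [this]; group
    rw [h2, show 18 = 1 + 2 * 8 + 1 by norm_num, pow_add, pow_add, pow_one]
    exact Set.mul_mem_mul (Set.mul_mem_mul (hTs.2 t ht) h1) ht
  refine ⟨S', ⟨hS's, ⟨4 * n + 3, ?_⟩, ⟨W, fun z hz => hAΓ (hWA hz), hW⟩⟩, hconj⟩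
  intro x hx
  have h1 : x ∈ S' ^ 8 := Set.subset_pow hS's.1 (by norm_num) hx
  have h2 := hconj 1 hA.1.1 x h1
  rw [one_mul, inv_one, mul_one] at h2
  rw [show 4 * n + 3 + 1 = (n + 1) * 4 by ring, pow_mul]
  exact Set.pow_subset_pow_left hn h2

end Helpers

/-- Iterating the normal version of Sanders' theorem yields symmetric sets `Sᵢ` with
`S₀ = A`, `S_{i+1}⁴ ⊆ Sᵢ⁴`, `a·S_{i+1}⁸·a⁻¹ ⊆ Sᵢ⁴` for all `a ∈ A`, and each `S_{i+1}`
wide in `A`; hence `H = ⋂ᵢ Sᵢ⁴` is a subgroup of `⟨A⟩` contained in `A⁴`, normalized by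
`A`, and every `Sᵢ⁴ ⊇ H` is wide in `A`. -/
theorem sanders_normal_iterated_chain {G : Type*} [Group G]
    (K : ℕ) (hK : 0 < K) (A : Set G) (hA : IsApproxSubgroup K A)
    (μ : Set G → ℝ≥0∞) (hμ : IsFinAddMeasure μ)
    (hinv : ∀ g ∈ Subgroup.closure A, ∀ X : Set G, μ (g • X) = μ X)
    (hμA : μ A = 1) :
    ∃ S : ℕ → Set G, S 0 = A ∧ (∀ i, IsSymmetric (S i)) ∧
      (∀ i, S (i + 1) ^ 4 ⊆ S i ^ 4) ∧
      (∀ i, ∀ a ∈ A, ∀ x ∈ S (i + 1) ^ 8, a * x * a⁻¹ ∈ S i ^ 4) ∧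
      (∀ i, ∃ Z : Finset G, A ⊆ (Z : Set G) * S (i + 1)) ∧
      ∃ H : Subgroup G, (H : Set G) = ⋂ i, S i ^ 4 ∧
        (H : Set G) ⊆ A ^ 4 ∧ H ≤ Subgroup.closure A ∧
        (∀ a ∈ A, ∀ h : G, h ∈ H ↔ a * h * a⁻¹ ∈ H) ∧
        ∀ i, (H : Set G) ⊆ S i ^ 4 ∧ ∃ Z : Finset G, A ⊆ (Z : Set G) * S i ^ 4 := by
  classical
  have hgood0 : ChainGood A A := ⟨hA.1, ⟨0, by simp⟩, TrCov.of_subset subset_rfl⟩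
  choose nxt hnxt hconj0 using fun S : {S : Set G // ChainGood A S} =>
    chain_step hA hμ hinv hμA S.2
  obtain ⟨S, hS0, hgood, hconj⟩ : ∃ S : ℕ → Set G, S 0 = A ∧ (∀ i, ChainGood A (S i)) ∧
      ∀ i, ∀ a ∈ A, ∀ x ∈ S (i + 1) ^ 8, a * x * a⁻¹ ∈ S i ^ 4 := by
    let C : ℕ → {S : Set G // ChainGood A S} :=
      fun i => Nat.rec ⟨A, hgood0⟩ (fun _ S => ⟨nxt S, hnxt S⟩) i
    exact ⟨fun i => (C i).1, rfl, fun i => (C i).2, fun i => hconj0 (C i)⟩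
  have hsym : ∀ i, IsSymmetric (S i) := fun i => (hgood i).1
  have h8 : ∀ i, S (i + 1) ^ 8 ⊆ S i ^ 4 := by
    intro i x hx
    have := hconj i 1 hA.1.1 x hx
    simpa using this
  have h48 : ∀ i, S i ^ 4 ⊆ S i ^ 8 :=
    fun i => Set.pow_subset_pow_right (hsym i).1 (by norm_num)
  have hcov : ∀ i, ∃ Z : Finset G, A ⊆ (Z : Set G) * S i := by
    intro i
    obtain ⟨Z, -, hZ⟩ := (hgood i).2.2
    exact ⟨Z, hZ⟩
  have hSinv : ∀ i, (S i)⁻¹ = S i := by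
    intro i
    ext x
    rw [Set.mem_inv]
    exact ⟨fun h => by simpa using (hsym i).2 _ h, fun h => (hsym i).2 _ h⟩
  let H : Subgroup G :=
    { carrier := ⋂ i, S i ^ 4
      one_mem' := by
        rw [Set.mem_iInter]
        intro i
        exact Set.one_mem_pow (hsym i).1
      mul_mem' := by
        intro a b ha hb
        rw [Set.mem_iInter] at ha hb ⊢
        intro i
        apply h8 i
        rw [show 8 = 4 + 4 by norm_num, pow_add]
        exact Set.mul_mem_mul (ha (i + 1)) (hb (i + 1))
      inv_mem' := by
        intro a ha
        rw [Set.mem_iInter] at ha ⊢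
        intro i
        rw [← hSinv i, inv_pow]
        exact Set.inv_mem_inv.2 (ha i) }
  have hHmem : ∀ h, h ∈ H ↔ ∀ i, h ∈ S i ^ 4 := fun h => Set.mem_iInter
  have hHA : (H : Set G) ⊆ A ^ 4 := fun h hh => hS0 ▸ (hHmem h).1 hh 0
  have hnorm : ∀ a ∈ A, ∀ h ∈ H, a * h * a⁻¹ ∈ H := by
    intro a ha h hh
    rw [hHmem] at hh ⊢
    exact fun i => hconj i a ha h (h48 _ (hh (i + 1)))
  refine ⟨S, hS0, hsym, fun i => (h48 _).trans (h8 i), hconj, fun i => hcov (i + 1),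
    H, rfl, hHA, ?_, ?_, ?_⟩
  · intro h hh
    exact pow_subset_subgroup Subgroup.subset_closure 4 (hHA hh)
  · intro a ha h
    refine ⟨hnorm a ha h, fun hh => ?_⟩
    have := hnorm a⁻¹ (hA.1.2 a ha) _ hh
    have e : a⁻¹ * (a * h * a⁻¹) * a⁻¹⁻¹ = h := by group
    rwa [e] at this
  · intro i
    refine ⟨fun h hh => (hHmem h).1 hh i, ?_⟩
    obtain ⟨Z, hZ⟩ := hcov i
    exact ⟨Z, hZ.trans (Set.mul_subset_mul_left (Set.subset_pow (hsym i).1 (by norm_num)))⟩
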